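/- Let R be a positively SG left Noetherian ring, M a semi-graded left R-module, and N an SG submodule of M. Then M is a torsion module if and only if both N and M/N are torsion modules (torsion being defined via the ideals R_{≥t}). -/

import Mathlib

open Pointwise

namespace SG

/-- A semi-graded ring: an internal direct sum decomposition `R = ⊕ₙ Rₙ` into additive
subgroups with `Rₘ·Rₙ ⊆ ⊕_{k ≤ m+n} R_k` and `1 ∈ R₀`. -/
def IsSGRing {R : Type*} [Ring R] (g : ℤ → AddSubgroup R) : Prop :=
  DirectSum.IsInternal g ∧
    (∀ m n : ℤ, ∀ a ∈ g m, ∀ b ∈ g n, a * b ∈ ⨆ k ≤ m + n, g k) ∧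
    (1 : R) ∈ g 0

/-- A semi-graded module over a semi-graded ring. -/
def IsSGModule {R M : Type*} [Ring R] [AddCommGroup M] [Module R M]
    (gR : ℤ → AddSubgroup R) (gM : ℤ → AddSubgroup M) : Prop :=
  DirectSum.IsInternal gM ∧
    ∀ m n : ℤ, 0 ≤ m → ∀ r ∈ gR m, ∀ x ∈ gM n, r • x ∈ ⨆ k ≤ m + n, gM k

/-- A submodule `P` is a semi-graded submodule when `P = ⊕ₙ (Mₙ ⊓ P)`. -/
def IsSGSubmodule {R M : Type*} [Ring R] [AddCommGroup M] [Module R M]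
    (gM : ℤ → AddSubgroup M) (P : Submodule R M) : Prop :=
  P.toAddSubgroup = ⨆ n : ℤ, (gM n ⊓ P.toAddSubgroup)

/-- `⟨X⟩^SG`: the intersection of all semi-graded submodules containing `X`. -/
def sgSpan {R M : Type*} [Ring R] [AddCommGroup M] [Module R M]
    (gM : ℤ → AddSubgroup M) (X : Set M) : Submodule R M :=
  sInf {P : Submodule R M | IsSGSubmodule gM P ∧ X ⊆ P}

/-- A (left) ideal is two-sided. -/
def IsTwoSided {R : Type*} [Ring R] (I : Ideal R) : Prop :=
  ∀ x ∈ I, ∀ r : R, x * r ∈ I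

/-- `R_{≥t}`: the intersection of all two-sided semi-graded ideals containing `⊕_{k ≥ t} R_k`. -/
def geIdeal {R : Type*} [Ring R] (gR : ℤ → AddSubgroup R) (t : ℕ) : Ideal R :=
  sInf {I : Ideal R | IsSGSubmodule gR I ∧ IsTwoSided I ∧
    ∀ k : ℤ, (t : ℤ) ≤ k → gR k ≤ I.toAddSubgroup}

/-- Powers of a (two-sided) ideal, `I⁰ = R`, `I^{n+1} = I·Iⁿ`. -/
def idealPow {R : Type*} [Ring R] (I : Ideal R) : ℕ → Ideal R
  | 0 => ⊤
  | n + 1 => Submodule.span R ((I : Set R) * (idealPow I n : Set R))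

/-- `x` is a torsion element: `(R_{≥t})ⁿ • x = 0` for some `n, t ∈ ℕ`. -/
def IsTorsionElem {R : Type*} [Ring R] (gR : ℤ → AddSubgroup R)
    {M : Type*} [AddCommGroup M] [Module R M] (x : M) : Prop :=
  ∃ t n : ℕ, ∀ y ∈ idealPow (geIdeal gR t) n, y • x = 0

/-- `R'_n`. -/
def RprimeN {R : Type*} [Ring R] (gR : ℤ → AddSubgroup R) (n : ℤ) : Set R :=
  {r : R | r ∈ gR n ∧ ∀ m : ℤ, ∀ h ∈ gR m, r * h ∈ gR (n + m)}

/-- `R' = ⋃ₙ R'_n`. -/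
def Rprime {R : Type*} [Ring R] (gR : ℤ → AddSubgroup R) : Set R :=
  ⋃ n : ℤ, RprimeN gR n

/-- `R''_n`. -/
def RdprimeN {R : Type*} [Ring R] (gR : ℤ → AddSubgroup R) (n : ℤ) : Set R :=
  {r : R | r ∈ RprimeN gR n ∧ ∀ m : ℤ, ∀ h ∈ gR m, h * r ∈ gR (n + m)}

/-- `R'' = ⋃ₙ R''_n`. -/
def Rdprime {R : Type*} [Ring R] (gR : ℤ → AddSubgroup R) : Set R :=
  ⋃ n : ℤ, RdprimeN gR n

/-- A multiplicatively closed set satisfying the left Ore condition. -/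
def IsLeftOreSet {R : Type*} [Ring R] (T : Set R) : Prop :=
  (1 : R) ∈ T ∧ (∀ a ∈ T, ∀ b ∈ T, a * b ∈ T) ∧
    ∀ r : R, ∀ s ∈ T, ∃ r' : R, ∃ s' ∈ T, s' * r = r' * s

/-- A good left Ore set. -/
def IsGoodOre {R : Type*} [Ring R] (gR : ℤ → AddSubgroup R) (T : Set R) : Prop :=
  IsLeftOreSet T ∧ T ⊆ Rdprime gR ∧
    ∀ s ∈ T, ∀ r ∈ Rprime gR, ∃ u ∈ Rprime gR, ∃ v ∈ T, u * s = v * r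

/-- A (left) schematic semi-graded ring: positively semi-graded, left Noetherian, with a
finite family of non-trivial good left Ore sets satisfying the schematic condition. -/
def IsSchematic {R : Type*} [Ring R] (gR : ℤ → AddSubgroup R) : Prop :=
  IsSGRing gR ∧ (∀ n : ℤ, n < 0 → gR n = ⊥) ∧ IsNoetherian R R ∧
    ∃ 𝒮 : Set (Set R), 𝒮.Finite ∧
      (∀ T ∈ 𝒮, IsGoodOre gR T ∧ ∃ x ∈ T, x ∈ ⨆ k ≥ (1 : ℤ), gR k) ∧
      ∀ xf : Set R → R, (∀ T ∈ 𝒮, xf T ∈ T) →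
        ∃ t m : ℕ, (idealPow (geIdeal gR t) m : Set R) ⊆
          ↑(⨆ T ∈ 𝒮, Ideal.span {xf T})

/-- `f^!(M)`: the largest semi-graded submodule of `M` annihilated by `J`, realized as the
sum of all semi-graded submodules annihilated by `J`. -/
def fShriek {R M : Type*} [Ring R] [AddCommGroup M] [Module R M]
    (gM : ℤ → AddSubgroup M) (J : Ideal R) : Submodule R M :=
  sSup {P : Submodule R M | IsSGSubmodule gM P ∧ ∀ j ∈ J, ∀ x ∈ P, j • x = 0}

/-- The induced semigraduation on a quotient module. -/
def quotGrade {R M : Type*} [Ring R] [AddCommGroup M] [Module R M]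
    (gM : ℤ → AddSubgroup M) (K : Submodule R M) : ℤ → AddSubgroup (M ⧸ K) :=
  fun n => (gM n).map (K.mkQ : M →ₗ[R] M ⧸ K).toAddMonoidHom

/-- Condition (*) on an ideal `J`. -/
def CondStar {R : Type*} [Ring R] (gR : ℤ → AddSubgroup R) (J : Ideal R) : Prop :=
  ∀ n t : ℕ, ∀ x ∈ J ⊓ idealPow (geIdeal gR t) n,
    ∃ nx tx : ℕ, ∀ y ∈ idealPow (geIdeal gR tx) nx,
      y * x ∈ Submodule.span R ((J : Set R) * (idealPow (geIdeal gR t) n : Set R))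

/-- Localizable semi-graded module: `R'_n · M_m ⊆ M_{n+m}`. -/
def IsLSG {R M : Type*} [Ring R] [AddCommGroup M] [Module R M]
    (gR : ℤ → AddSubgroup R) (gM : ℤ → AddSubgroup M) : Prop :=
  IsSGModule gR gM ∧
    ∀ n m : ℤ, ∀ r ∈ RprimeN gR n, ∀ x ∈ gM m, r • x ∈ gM (n + m)

universe v

/-- `E` is T-injective (in the category of all modules): maps into `E` from a submodule with
torsion quotient extend. -/
def TInjective {R : Type*} [Ring R] (gR : ℤ → AddSubgroup R)
    (E : Type*) [AddCommGroup E] [Module R E] : Prop :=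
  ∀ (M : Type v) [AddCommGroup M] [Module R M] (P : Submodule R M),
    (∀ x : M ⧸ P, IsTorsionElem gR x) →
      ∀ f : P →ₗ[R] E, ∃ g : M →ₗ[R] E, ∀ x : P, g (x : M) = f x

/-- `E` is T-injective within the category of LSG modules and homogeneous maps. -/
def TInjectiveLSG {R : Type*} [Ring R] (gR : ℤ → AddSubgroup R)
    {E : Type*} [AddCommGroup E] [Module R E] (gE : ℤ → AddSubgroup E) : Prop :=
  ∀ (M : Type v) [AddCommGroup M] [Module R M] (gM : ℤ → AddSubgroup M),
    IsLSG gR gM →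
    ∀ P : Submodule R M, IsSGSubmodule gM P →
      (∀ x : M ⧸ P, IsTorsionElem gR x) →
      ∀ f : P →ₗ[R] E, (∀ n : ℤ, ∀ x : P, (x : M) ∈ gM n → f x ∈ gE n) →
        ∃ g : M →ₗ[R] E, (∀ x : P, g (x : M) = f x) ∧
          ∀ n : ℤ, ∀ x ∈ gM n, g x ∈ gE n

end SG

namespace SG

theorem geIdeal_twoSided {R : Type*} [Ring R] (gR : ℤ → AddSubgroup R) (t : ℕ) :
    IsTwoSided (geIdeal gR t) := by
  intro x hx r
  unfold geIdeal at hx ⊢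
  rw [Submodule.mem_sInf] at hx ⊢
  intro I hI
  exact hI.2.1 x (hx I hI) r

theorem geIdeal_anti {R : Type*} [Ring R] (gR : ℤ → AddSubgroup R) {s t : ℕ} (h : s ≤ t) :
    geIdeal gR t ≤ geIdeal gR s := by
  refine sInf_le_sInf ?_
  rintro I ⟨h1, h2, h3⟩
  exact ⟨h1, h2, fun k hk => h3 k (le_trans (by exact_mod_cast h) hk)⟩

theorem idealPow_mono {R : Type*} [Ring R] {I J : Ideal R} (h : I ≤ J) (n : ℕ) :
    idealPow I n ≤ idealPow J n := by
  induction n with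
  | zero => exact le_refl _
  | succ n ih => exact Submodule.span_mono (Set.mul_subset_mul h ih)

theorem idealPow_anti {R : Type*} [Ring R] (I : Ideal R) {m n : ℕ} (h : m ≤ n) :
    idealPow I n ≤ idealPow I m := by
  induction n, h using Nat.le_induction with
  | base => exact le_refl _
  | succ n _ ih =>
    refine le_trans ?_ ih
    refine Submodule.span_le.2 ?_
    rintro _ ⟨a, _, b, hb, rfl⟩
    exact (idealPow I n).mul_mem_left a hb

theorem idealPow_twoSided {R : Type*} [Ring R] {I : Ideal R} (n : ℕ) :
    IsTwoSided (idealPow I n) := by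
  induction n with
  | zero => intro x _ r; exact Submodule.mem_top
  | succ n ih =>
    intro x hx r
    refine Submodule.span_induction (p := fun x _ => x * r ∈ idealPow I (n + 1))
      ?_ ?_ ?_ ?_ hx
    · rintro _ ⟨a, ha, b, hb, rfl⟩
      refine Submodule.subset_span ⟨a, ha, b * r, ih b hb r, (mul_assoc a b r).symm⟩
    · rw [zero_mul]; exact Submodule.zero_mem _
    · intro x y _ _ hx hy
      rw [add_mul]; exact Submodule.add_mem _ hx hy
    · intro a x _ hx
      rw [smul_mul_assoc]; exact Submodule.smul_mem _ a hx

theorem idealPow_add {R : Type*} [Ring R] {I : Ideal R} (hI : IsTwoSided I) (m n : ℕ) :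
    idealPow I (m + n) ≤
      Submodule.span R ((idealPow I m : Set R) * (idealPow I n : Set R)) := by
  induction m with
  | zero =>
    intro x hx
    rw [Nat.zero_add] at hx
    exact Submodule.subset_span ⟨1, Submodule.mem_top, x, hx, one_mul x⟩
  | succ m ih =>
    rw [Nat.add_right_comm]
    refine Submodule.span_le.2 ?_
    rintro _ ⟨a, ha, b, hb, rfl⟩
    have key : ∀ a ∈ I, a * b ∈
        Submodule.span R ((idealPow I (m + 1) : Set R) * (idealPow I n : Set R)) := by
      refine Submodule.span_induction (p := fun b _ => ∀ a ∈ I, a * b ∈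
        Submodule.span R ((idealPow I (m + 1) : Set R) * (idealPow I n : Set R)))
        ?_ ?_ ?_ ?_ (ih hb)
      · rintro _ ⟨c, hc, d, hd, rfl⟩ a ha
        exact Submodule.subset_span
          ⟨a * c, Submodule.subset_span ⟨a, ha, c, hc, rfl⟩, d, hd, mul_assoc a c d⟩
      · intro a _; rw [mul_zero]; exact Submodule.zero_mem _
      · intro x y _ _ hx hy a ha
        rw [mul_add]; exact Submodule.add_mem _ (hx a ha) (hy a ha)
      · intro r x _ hx a ha
        rw [smul_eq_mul, ← mul_assoc]
        exact hx (a * r) (hI a ha r)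
    exact key a ha

theorem kill_mono {R M : Type*} [Ring R] [AddCommGroup M] [Module R M]
    (gR : ℤ → AddSubgroup R) {s t m n : ℕ} (h : s ≤ t) (hmn : m ≤ n) {x : M}
    (hx : ∀ y ∈ idealPow (geIdeal gR s) m, y • x = 0) :
    ∀ y ∈ idealPow (geIdeal gR t) n, y • x = 0 := fun y hy =>
  hx y (idealPow_mono (geIdeal_anti gR h) m (idealPow_anti _ hmn hy))

end SG

/-- for an SG submodule `P` of an SG module `M` over a positively SG left
Noetherian ring, `M` is torsion iff both `P` and `M/P` are torsion. -/
theorem stmt_16 {R M : Type*} [Ring R] [AddCommGroup M] [Module R M]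
    (gR : ℤ → AddSubgroup R) (gM : ℤ → AddSubgroup M)
    (hR : SG.IsSGRing gR) (hpos : ∀ n : ℤ, n < 0 → gR n = ⊥)
    (hnoe : IsNoetherian R R)
    (hM : SG.IsSGModule gR gM) (P : Submodule R M) (hP : SG.IsSGSubmodule gM P) :
    (∀ x : M, SG.IsTorsionElem gR x) ↔
      ((∀ x ∈ P, SG.IsTorsionElem gR x) ∧ ∀ x : M ⧸ P, SG.IsTorsionElem gR x) := by
  constructor
  · intro h
    refine ⟨fun x _ => h x, fun x => ?_⟩
    obtain ⟨x, rfl⟩ := P.mkQ_surjective x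
    obtain ⟨t, n, hx⟩ := h x
    refine ⟨t, n, fun y hy => ?_⟩
    rw [← map_smul, hx y hy, map_zero]
  · rintro ⟨h1, h2⟩ x
    obtain ⟨t, n, hx⟩ := h2 (P.mkQ x)
    have hxP : ∀ y ∈ SG.idealPow (SG.geIdeal gR t) n, y • x ∈ P := by
      intro y hy
      have := hx y hy
      rwa [← map_smul, Submodule.mkQ_apply, Submodule.Quotient.mk_eq_zero] at this
    obtain ⟨S, hS⟩ := hnoe.noetherian (SG.idealPow (SG.geIdeal gR t) n)
    have hSt : ∀ a : S, SG.IsTorsionElem gR ((a : R) • x) := fun a =>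
      h1 _ (hxP a (hS ▸ Submodule.subset_span a.2))
    choose tf nf hf using hSt
    let T := t + ∑ a, tf a
    let N := ∑ a, nf a
    have hkill : ∀ a ∈ S, ∀ y ∈ SG.idealPow (SG.geIdeal gR T) N, y • (a • x) = 0 := by
      intro a ha
      refine SG.kill_mono gR ?_ ?_ (hf ⟨a, ha⟩)
      · exact le_trans (Finset.single_le_sum (f := tf) (fun _ _ => Nat.zero_le _)
          (Finset.mem_univ _)) (Nat.le_add_left _ _)
      · exact Finset.single_le_sum (f := nf) (fun _ _ => Nat.zero_le _) (Finset.mem_univ _)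
    have hkill2 : ∀ z ∈ SG.idealPow (SG.geIdeal gR t) n,
        ∀ y ∈ SG.idealPow (SG.geIdeal gR T) N, y • (z • x) = 0 := by
      intro z hz
      rw [← hS] at hz
      refine Submodule.span_induction
        (p := fun z _ => ∀ y ∈ SG.idealPow (SG.geIdeal gR T) N, y • (z • x) = 0)
        ?_ ?_ ?_ ?_ hz
      · intro a ha
        exact hkill a ha
      · intro y _; rw [zero_smul, smul_zero]
      · intro u v _ _ hu hv y hy
        rw [add_smul, smul_add, hu y hy, hv y hy, add_zero]
      · intro r u _ hu y hy
        rw [smul_assoc, ← mul_smul]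
        exact hu _ (SG.idealPow_twoSided N y hy r)
    refine ⟨T, N + n, fun w hw => ?_⟩
    refine Submodule.span_induction (p := fun w _ => w • x = 0) ?_ ?_ ?_ ?_
      (SG.idealPow_add (SG.geIdeal_twoSided gR T) N n hw)
    · rintro _ ⟨y, hy, z, hz, rfl⟩
      change (y * z) • x = 0
      rw [mul_smul]
      exact hkill2 z (SG.idealPow_mono (SG.geIdeal_anti gR (Nat.le_add_right _ _)) n hz) y hy
    · exact zero_smul R x
    · intro u v _ _ hu hv
      rw [add_smul, hu, hv, add_zero]
    · intro r u _ hu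
      rw [smul_assoc, hu, smul_zero]
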